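/- arXiv:2403.03887 — 2 statements merged into one kernel-verified Lean document; each statement's English description precedes it below -/
import Mathlib

section
/- Let G be a strongly distorted group. Then G has uncountable cofinality: G cannot be written as the union of a strictly increasing sequence (H_n)_{n∈ℕ} of proper subgroups; that is, there is no sequence of subgroups H_n of G with H_n ⊊ H_{n+1} for all n, H_n ≠ G for all n, and ⋃_{n∈ℕ} H_n = G. -/
open Pointwise

/-- A group `G` is *strongly distorted* if there exist `m : ℕ` and a sequence
`w : ℕ → ℕ` such that for every sequence `g : ℕ → G` there is a subset `S` of `G`
of cardinality `m` with `g n ∈ S ^ (w n)` for every `n`. -/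
def StronglyDistorted (G : Type*) [Group G] : Prop :=
  ∃ (m : ℕ) (w : ℕ → ℕ), ∀ g : ℕ → G, ∃ S : Set G,
    S.Finite ∧ S.ncard = m ∧ ∀ n, g n ∈ S ^ w n

/-- A strongly distorted group has uncountable cofinality: it is not the union of a
strictly increasing sequence of proper subgroups. -/
theorem uncountable_cofinality_of_stronglyDistorted {G : Type*} [Group G]
    (hG : StronglyDistorted G) :
    ¬ ∃ H : ℕ → Subgroup G,
        (∀ n, H n < H (n + 1)) ∧ (∀ n, H n ≠ ⊤) ∧
        (⋃ n, (H n : Set G)) = Set.univ := by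
  rintro ⟨H, hlt, hne, hU⟩
  obtain ⟨m, w, hw⟩ := hG
  have hmono : Monotone H := monotone_nat_of_le_succ fun n => (hlt n).le
  have hex : ∀ n, ∃ x, x ∉ H n := fun n => by
    by_contra! h
    exact hne n ((Subgroup.eq_top_iff' _).2 h)
  choose g hg using hex
  obtain ⟨S, hfin, -, hS⟩ := hw g
  have hdir : Directed (· ⊆ ·) fun n => (H n : Set G) :=
    Monotone.directed_le fun _ _ hab => hmono hab
  obtain ⟨N, hN⟩ := hdir.exists_mem_subset_of_finset_subset_biUnion (s := hfin.toFinset)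
    (by simp [hU])
  exact hg N (Subgroup.pow_subset (by simpa using hN) (hS N))
end

section
/- Let G be a strongly distorted group. Then G has no normal subgroup of denumerable index: there is no normal subgroup N of G such that the quotient group G/N is countably infinite. -/
open Pointwise

/-- In a countable infinite group, every prescribed sequence of exponents admits a sequence of
elements that no finite set reaches within those exponents. -/
theorem exists_seq_forall_finite_exists_notMem_pow (Q : Type*) [Group Q] [Countable Q] [Infinite Q]
    (w : ℕ → ℕ) : ∃ q : ℕ → Q, ∀ T : Set Q, T.Finite → ∃ n, q n ∉ T ^ w n := by
  obtain ⟨F, hF⟩ := exists_surjective_nat (Finset Q)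
  have hfin (n : ℕ) : ((F n : Set Q) ^ w n).Finite := by
    classical
    exact Finset.coe_pow (F n) (w n) ▸ Finset.finite_toSet _
  choose q hq using fun n => (hfin n).exists_notMem
  refine ⟨q, fun T hT => ?_⟩
  obtain ⟨n, hn⟩ := hF hT.toFinset
  refine ⟨n, ?_⟩
  simpa [hn] using hq n

/-- A strongly distorted group has no normal subgroup of denumerable (countably
infinite) index. -/
theorem no_denumerable_index_normal_subgroup_of_stronglyDistorted {G : Type*} [Group G]
    (hG : StronglyDistorted G) :
    ¬ ∃ N : Subgroup G, N.Normal ∧ Countable (G ⧸ N) ∧ Infinite (G ⧸ N) := by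
  rintro ⟨N, _, _, _⟩
  obtain ⟨m, w, hw⟩ := hG
  obtain ⟨q, hq⟩ := exists_seq_forall_finite_exists_notMem_pow (G ⧸ N) w
  choose g hg using fun n => QuotientGroup.mk'_surjective N (q n)
  obtain ⟨S, hS, -, hgS⟩ := hw g
  obtain ⟨n, hn⟩ := hq (QuotientGroup.mk' N '' S) (hS.image _)
  apply hn
  rw [← Set.image_pow, ← hg n]
  exact Set.mem_image_of_mem _ (hgS n)
end
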